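/- arXiv:1403.0159 — 2 statements merged into one kernel-verified Lean document; each statement's English description precedes it below -/
import Mathlib

section
/- For any positive integer i, Σ_{m=4,8,12,...} 1/(m²i² - 1) = (1/2)·(1 - (π/(4i))·cot(π/(4i))). -/
theorem sum_mult_four_inv (i : ℕ) (hi : 0 < i) :
    ∑' m : ℕ, (1 : ℝ) / ((4 * (m + 1) : ℝ) ^ 2 * (i : ℝ) ^ 2 - 1)
      = (1 / 2) * (1 - (Real.pi / (4 * i)) * Real.cot (Real.pi / (4 * i))) := by
  have hi0 : (i : ℂ) ≠ 0 := by exact_mod_cast hi.ne'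
  have hx : (1 / (4 * i) : ℂ) ∈ Complex.integerComplement := by
    rintro ⟨k, hk⟩
    rw [eq_div_iff (by simpa using hi0)] at hk
    have h : k * (4 * (i : ℤ)) = 1 := by exact_mod_cast hk
    have : (4 : ℤ) ∣ 1 := ⟨k * i, by rw [← h]; ring⟩
    omega
  have key := cot_series_rep' hx
  apply Complex.ofReal_injective
  rw [Complex.ofReal_tsum]
  have hterm : ∀ m : ℕ, (((1 : ℝ) / ((4 * (m + 1) : ℝ) ^ 2 * (i : ℝ) ^ 2 - 1) : ℝ) : ℂ)
      = (-(1 / (8 * i) : ℂ)) * (1 / (1 / (4 * i) - ((m : ℂ) + 1)) + 1 / (1 / (4 * i) + ((m : ℂ) + 1))) := by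
    intro m
    have h1 : (1 / (4 * i) : ℂ) + ((m : ℂ) + 1) ≠ 0 := by
      simpa using Complex.integerComplement_add_ne_zero hx ((m : ℤ) + 1)
    have h2 : (1 / (4 * i) : ℂ) - ((m : ℂ) + 1) ≠ 0 := by
      simpa [sub_eq_add_neg] using Complex.integerComplement_add_ne_zero hx (-((m : ℤ) + 1))
    have e : (4 * ((m : ℂ) + 1)) ^ 2 * (i : ℂ) ^ 2 - 1
        = -(16 * i ^ 2) * ((1 / (4 * i) + ((m : ℂ) + 1)) * (1 / (4 * i) - ((m : ℂ) + 1))) := by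
      field_simp
      ring
    push_cast
    rw [e, one_div_add_one_div h2 h1]
    generalize hA : (1 / (4 * i) : ℂ) + ((m : ℂ) + 1) = A at *
    generalize hB : (1 / (4 * i) : ℂ) - ((m : ℂ) + 1) = B at *
    have hs : B + A = 1 / (2 * i) := by
      rw [← hA, ← hB]; field_simp; ring
    rw [hs]
    field_simp
    try ring
  simp_rw [hterm]
  rw [tsum_mul_left, ← key]
  have ha : (Real.pi : ℂ) * (1 / (4 * i)) = Real.pi / (4 * i) := by ring
  rw [ha]
  push_cast
  field_simp
  ring
end

section
/- For positive integers i ≠ j, the integral 2·∫₀¹ |sin(2πix)|·|sin(2πjx)| dx equals (4/π²)·(2 + Σ_{m=2,4,6,...} 4/((m²𝐢²-1)(m²𝐣²-1))), where 𝐢 = i/gcd(i,j) and 𝐣 = j/gcd(i,j). -/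
noncomputable def sinCoeff (n : ℤ) : ℝ := -2 / (Real.pi * (4 * (n : ℝ) ^ 2 - 1))

theorem four_sq_sub_one_ne (n : ℤ) : (4 * (n : ℝ) ^ 2 - 1) ≠ 0 := by
  have : (4 * n ^ 2 - 1 : ℤ) ≠ 0 := by omega
  exact_mod_cast this

theorem sinCoeff_integral (n : ℤ) :
    ∫ x in (0:ℝ)..1, Complex.exp (2 * Real.pi * Complex.I * (-n : ℤ) * x) *
      ((|Real.sin (Real.pi * x)| : ℝ) : ℂ) = (sinCoeff n : ℂ) := by
  have h1 : ∫ x in (0:ℝ)..1, Complex.exp (2 * Real.pi * Complex.I * (-n : ℤ) * x) *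
      ((|Real.sin (Real.pi * x)| : ℝ) : ℂ) =
      ∫ x in (0:ℝ)..1, Complex.exp (2 * Real.pi * Complex.I * (-n : ℤ) * x) *
        Complex.sin (Real.pi * x) := by
    apply intervalIntegral.integral_congr
    intro x hx
    rw [Set.uIcc_of_le zero_le_one] at hx
    have : 0 ≤ Real.sin (Real.pi * x) := by
      apply Real.sin_nonneg_of_nonneg_of_le_pi
      · have := Real.pi_pos; have := hx.1; positivity
      · nlinarith [Real.pi_pos, hx.2]
    simp only [abs_of_nonneg this]
    push_cast
    rfl
  rw [h1]
  have hpi : (Real.pi : ℂ) ≠ 0 := by exact_mod_cast Real.pi_ne_zero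
  have hn : (4 * (n : ℂ) ^ 2 - 1) ≠ 0 := by exact_mod_cast four_sq_sub_one_ne n
  set a : ℂ := 2 * Real.pi * Complex.I * (-n : ℤ) with ha
  have hD : a ^ 2 + (Real.pi : ℂ) ^ 2 = - (Real.pi : ℂ) ^ 2 * (4 * (n : ℂ) ^ 2 - 1) := by
    rw [ha]; push_cast; linear_combination (4 * (Real.pi : ℂ) ^ 2 * n ^ 2) * Complex.I_sq
  have hD0 : a ^ 2 + (Real.pi : ℂ) ^ 2 ≠ 0 := by
    rw [hD]; exact mul_ne_zero (neg_ne_zero.mpr (pow_ne_zero _ hpi)) hn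
  have hder : ∀ x ∈ Set.uIcc (0:ℝ) 1, HasDerivAt (fun x : ℝ => Complex.exp (a * x) *
      (a * Complex.sin (Real.pi * x) - Real.pi * Complex.cos (Real.pi * x)) /
        (a ^ 2 + (Real.pi : ℂ) ^ 2))
      (Complex.exp (a * x) * Complex.sin (Real.pi * x)) x := by
    intro x _
    have h0 : HasDerivAt (fun z : ℂ => Complex.exp (a * z) *
      (a * Complex.sin (Real.pi * z) - Real.pi * Complex.cos (Real.pi * z)) /
        (a ^ 2 + (Real.pi : ℂ) ^ 2)) (Complex.exp (a * x) * Complex.sin (Real.pi * x)) (x : ℂ) := by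
      have e1 : HasDerivAt (fun z : ℂ => a * z) a (x : ℂ) := by
        simpa using (hasDerivAt_id (x : ℂ)).const_mul a
      have e2 : HasDerivAt (fun z : ℂ => (Real.pi : ℂ) * z) (Real.pi : ℂ) (x : ℂ) := by
        simpa using (hasDerivAt_id (x : ℂ)).const_mul (Real.pi : ℂ)
      have := (e1.cexp.mul ((e2.csin.const_mul a).sub (e2.ccos.const_mul (Real.pi : ℂ)))).div_const
        (a ^ 2 + (Real.pi : ℂ) ^ 2)
      refine this.congr_deriv ?_
      rw [div_eq_iff hD0]
      simp only [Pi.mul_apply, Pi.sub_apply]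
      ring
    exact h0.comp_ofReal
  rw [intervalIntegral.integral_eq_sub_of_hasDerivAt hder
    (Continuous.intervalIntegrable (by fun_prop) _ _)]
  have hexp : Complex.exp a = 1 := by
    rw [Complex.exp_eq_one_iff]; exact ⟨-n, by rw [ha]; ring⟩
  simp only [Complex.ofReal_one, Complex.ofReal_zero, mul_one, mul_zero, Complex.exp_zero, hexp,
    Complex.sin_pi, Complex.cos_pi, Complex.sin_zero, Complex.cos_zero, hD, sinCoeff]
  push_cast
  field_simp
  ring

theorem sinCoeff_summable : Summable sinCoeff := by
  have h : Summable fun n : ℤ => 1 / (n : ℝ) ^ 2 := Real.summable_one_div_int_pow.mpr (by norm_num)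
  have h2 : Summable fun n : ℤ => (if n = 0 then (1 : ℝ) else 0) :=
    summable_of_ne_finset_zero (s := {0}) (by intro b hb; simp at hb; simp [hb])
  refine Summable.of_norm_bounded (h.add h2) ?_
  intro n
  rw [sinCoeff, norm_div, norm_mul, Real.norm_of_nonneg Real.pi_pos.le]
  by_cases hn : n = 0
  · subst hn
    simp
    rw [div_le_one Real.pi_pos]
    exact Real.two_le_pi
  · have h1 : (1 : ℝ) ≤ (n : ℝ) ^ 2 := by
      have : (1 : ℤ) ≤ n ^ 2 := by have := sq_pos_of_ne_zero hn; omega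
      exact_mod_cast this
    simp only [hn, if_false, add_zero]
    rw [Real.norm_of_nonneg (by linarith : (0:ℝ) ≤ 4 * (n : ℝ) ^ 2 - 1), norm_neg,
      Real.norm_of_nonneg (by norm_num : (0:ℝ) ≤ 2)]
    rw [div_le_div_iff₀ (by have := Real.pi_pos; apply mul_pos this; linarith) (by linarith)]
    nlinarith [Real.two_le_pi]

theorem sin_hasSum (x : ℝ) :
    HasSum (fun n : ℤ => (sinCoeff n : ℂ) * Complex.exp (2 * Real.pi * Complex.I * n * x))
      ((|Real.sin (Real.pi * x)| : ℝ) : ℂ) := by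
  have : Fact (0 < (1:ℝ)) := ⟨one_pos⟩
  have hper : Function.Periodic (fun x : ℝ => ((|Real.sin (Real.pi * x)| : ℝ) : ℂ)) 1 := by
    intro x
    simp [mul_add, Real.sin_add_pi]
  let f : C(AddCircle (1:ℝ), ℂ) := ⟨hper.lift, by
    apply continuous_coinduced_dom.mpr
    show Continuous (fun x : ℝ => ((|Real.sin (Real.pi * x)| : ℝ) : ℂ))
    fun_prop⟩
  have hf : ∀ x : ℝ, f (x : AddCircle (1:ℝ)) = ((|Real.sin (Real.pi * x)| : ℝ) : ℂ) := fun x => rfl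
  have hc : ∀ n, fourierCoeff f n = (sinCoeff n : ℂ) := by
    intro n
    rw [fourierCoeff_eq_intervalIntegral f n 0, ← sinCoeff_integral n]
    simp only [hf, fourier_coe_apply]
    simp
  have hs : Summable (fourierCoeff f) := by
    have : fourierCoeff f = fun n => (sinCoeff n : ℂ) := funext hc
    rw [this]
    exact Complex.ofRealCLM.summable sinCoeff_summable
  have := has_pointwise_sum_fourier_series_of_summable hs (x : AddCircle (1:ℝ))
  simpa [hc, hf, fourier_coe_apply] using this


theorem exp_integral (n : ℤ) :
    ∫ x in (0:ℝ)..1, Complex.exp (2 * Real.pi * Complex.I * n * x) = if n = 0 then 1 else 0 := by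
  split_ifs with h
  · subst h; simp
  · have hpi : (Real.pi : ℂ) ≠ 0 := by exact_mod_cast Real.pi_ne_zero
    have hn : (n : ℂ) ≠ 0 := by exact_mod_cast h
    have hc : 2 * (Real.pi : ℂ) * Complex.I * n ≠ 0 := by simp [h, hpi]
    rw [integral_exp_mul_complex hc]
    have hexp : Complex.exp (2 * (Real.pi : ℂ) * Complex.I * n) = 1 := by
      rw [Complex.exp_eq_one_iff]; exact ⟨n, by ring⟩
    simp [hexp]

theorem exp_norm_one (n : ℤ) (x : ℝ) :
    ‖Complex.exp (2 * Real.pi * Complex.I * n * x)‖ = 1 := by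
  have : 2 * (Real.pi : ℂ) * Complex.I * n * x = ((2 * Real.pi * n * x : ℝ) : ℂ) * Complex.I := by
    push_cast; ring
  rw [this, Complex.norm_exp_ofReal_mul_I]

theorem norm_summable : Summable fun n => ‖(sinCoeff n : ℂ)‖ :=
  sinCoeff_summable.norm.congr fun n => (Complex.norm_real (sinCoeff n)).symm

theorem prod_summable :
    Summable fun p : ℤ × ℤ => ‖(sinCoeff p.1 : ℂ) * (sinCoeff p.2 : ℂ)‖ :=
  Summable.mul_norm (f := fun n : ℤ => (sinCoeff n : ℂ)) (g := fun n : ℤ => (sinCoeff n : ℂ))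
    norm_summable norm_summable

theorem prod_pointwise (i j : ℕ) (x : ℝ) :
    HasSum (fun p : ℤ × ℤ => ((sinCoeff p.1 : ℂ) * (sinCoeff p.2 : ℂ)) *
      Complex.exp (2 * Real.pi * Complex.I * ((2 * (p.1 * i + p.2 * j) : ℤ)) * x))
      ((|Real.sin (2 * Real.pi * i * x)| * |Real.sin (2 * Real.pi * j * x)| : ℝ) : ℂ) := by
  have h1 := sin_hasSum (2 * i * x)
  have h2 := sin_hasSum (2 * j * x)
  have n1 : ∀ y : ℝ, Summable fun n : ℤ => ‖(sinCoeff n : ℂ) *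
      Complex.exp (2 * Real.pi * Complex.I * n * (y : ℂ))‖ := by
    intro y
    refine norm_summable.congr fun n => ?_
    rw [norm_mul, exp_norm_one, mul_one]
  have h3 := h1.mul h2 (summable_mul_of_summable_norm
    (f := fun n : ℤ => (sinCoeff n : ℂ) *
      Complex.exp (2 * Real.pi * Complex.I * n * ((2 * i * x : ℝ) : ℂ)))
    (g := fun n : ℤ => (sinCoeff n : ℂ) *
      Complex.exp (2 * Real.pi * Complex.I * n * ((2 * j * x : ℝ) : ℂ))) (n1 _) (n1 _))
  rw [← Complex.ofReal_mul, show Real.pi * (2 * i * x) = 2 * Real.pi * i * x by ring,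
    show Real.pi * (2 * j * x) = 2 * Real.pi * j * x by ring] at h3
  convert! h3 using 1
  funext p
  rw [mul_mul_mul_comm, ← Complex.exp_add]
  congr 2
  push_cast
  ring

theorem prod_integral (i j : ℕ) :
    HasSum (fun p : ℤ × ℤ => (sinCoeff p.1 : ℂ) * (sinCoeff p.2 : ℂ) *
      (if p.1 * i + p.2 * j = 0 then 1 else 0))
      (((∫ x in (0:ℝ)..1, |Real.sin (2 * Real.pi * i * x)| * |Real.sin (2 * Real.pi * j * x)|
        : ℝ)) : ℂ) := by
  have key : HasSum (fun p : ℤ × ℤ => ∫ x in (0:ℝ)..1,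
      ((sinCoeff p.1 : ℂ) * (sinCoeff p.2 : ℂ)) *
      Complex.exp (2 * Real.pi * Complex.I * ((2 * (p.1 * i + p.2 * j) : ℤ)) * x))
      (∫ x in (0:ℝ)..1, ((|Real.sin (2 * Real.pi * i * x)| * |Real.sin (2 * Real.pi * j * x)|
      : ℝ) : ℂ)) := by
    apply intervalIntegral.hasSum_integral_of_dominated_convergence
      (fun p _ => ‖(sinCoeff p.1 : ℂ) * (sinCoeff p.2 : ℂ)‖)
    · intro p
      exact Continuous.aestronglyMeasurable (by fun_prop)
    · intro p
      refine Filter.Eventually.of_forall fun x _ => ?_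
      rw [norm_mul _ (Complex.exp _), exp_norm_one, mul_one]
    · exact Filter.Eventually.of_forall fun x _ => prod_summable
    · exact intervalIntegrable_const
    · exact Filter.Eventually.of_forall fun x _ => prod_pointwise i j x
  rw [intervalIntegral.integral_ofReal] at key
  convert! key using 1
  funext p
  rw [intervalIntegral.integral_const_mul, exp_integral]
  congr 1
  simp

theorem diag_hasSum (i j : ℕ) (hi : 0 < i) (hj : 0 < j) :
    HasSum (fun n : ℤ => sinCoeff (n * (j / Nat.gcd i j : ℕ)) * sinCoeff (n * (i / Nat.gcd i j : ℕ)))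
      (∫ x in (0:ℝ)..1, |Real.sin (2 * Real.pi * i * x)| * |Real.sin (2 * Real.pi * j * x)|) := by
  have hg : 0 < Nat.gcd i j := Nat.gcd_pos_of_pos_left _ hi
  have hcop := Nat.coprime_div_gcd_div_gcd hg
  have hi' : i = Nat.gcd i j * (i / Nat.gcd i j) := (Nat.mul_div_cancel' (Nat.gcd_dvd_left i j)).symm
  have hj' : j = Nat.gcd i j * (j / Nat.gcd i j) := (Nat.mul_div_cancel' (Nat.gcd_dvd_right i j)).symm
  have H := prod_integral i j
  generalize Nat.gcd i j = g at *
  generalize i / g = a at *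
  generalize j / g = b at *
  have hb : (b : ℤ) ≠ 0 := by rintro h; simp at h; subst h; omega
  have hg' : (g : ℤ) ≠ 0 := by omega
  have hiff : ∀ p : ℤ × ℤ, p.1 * i + p.2 * j = 0 ↔ p.1 * a + p.2 * b = 0 := by
    intro p
    rw [hi', hj']
    push_cast
    rw [show p.1 * ((g : ℤ) * a) + p.2 * (g * b) = g * (p.1 * a + p.2 * b) by ring]
    rw [mul_eq_zero, or_iff_right hg']
  have hinj : Function.Injective (fun n : ℤ => ((n * b, -(n * a)) : ℤ × ℤ)) := by
    intro m n h
    simp only [Prod.mk.injEq] at h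
    exact mul_right_cancel₀ hb h.1
  rw [← hinj.hasSum_iff] at H
  · rw [← Complex.hasSum_ofReal]
    convert H using 1
    funext n
    have : (n * b) * (i : ℤ) + (-(n * a)) * j = 0 := by
      have := (hiff (n * b, -(n * a))).mpr (by simp only []; ring)
      exact this
    simp only [Function.comp, this, if_true, mul_one]
    push_cast
    congr 2
    simp [sinCoeff]
  · intro p hp
    rw [if_neg, mul_zero]
    intro h0
    apply hp
    rw [hiff] at h0
    have hc : IsCoprime (b : ℤ) (a : ℤ) := Nat.isCoprime_iff_coprime.mpr hcop.symm
    have hd : (b : ℤ) ∣ p.1 * a := ⟨-p.2, by linarith⟩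
    obtain ⟨n, hn⟩ := hc.dvd_of_dvd_mul_right hd
    refine ⟨n, ?_⟩
    ext
    · simp [hn, mul_comm]
    · simp only []
      apply mul_right_cancel₀ hb
      rw [hn] at h0
      linarith


theorem integral_abs_sin_prod (i j : ℕ) (hi : 0 < i) (hj : 0 < j) (hij : i ≠ j) :
    2 * ∫ x in (0:ℝ)..1, |Real.sin (2 * Real.pi * i * x)| * |Real.sin (2 * Real.pi * j * x)|
      = (4 / Real.pi ^ 2) *
        (2 + ∑' m : ℕ,
          4 / (((2 * (m + 1) : ℝ) ^ 2 * ((i / Nat.gcd i j : ℕ) : ℝ) ^ 2 - 1) *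
               ((2 * (m + 1) : ℝ) ^ 2 * ((j / Nat.gcd i j : ℕ) : ℝ) ^ 2 - 1))) := by
  have H := diag_hasSum i j hi hj
  generalize (∫ x in (0:ℝ)..1, |Real.sin (2 * Real.pi * i * x)| * |Real.sin (2 * Real.pi * j * x)|)
    = S at *
  generalize i / Nat.gcd i j = a at *
  generalize j / Nat.gcd i j = b at *
  set f : ℤ → ℝ := fun n => sinCoeff (n * b) * sinCoeff (n * a) with hf
  have e := tsum_of_add_one_of_neg_add_one (f := f)
    (H.summable.comp_injective (i := fun n : ℕ => ((n : ℤ) + 1)) (fun m n h => by simpa using h))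
    (H.summable.comp_injective (i := fun n : ℕ => (-((n : ℤ) + 1))) (fun m n h => by simpa using h))
  rw [H.tsum_eq] at e
  have hneg : ∀ n : ℕ, f (-((n : ℤ) + 1)) = f ((n : ℤ) + 1) := by
    intro n
    simp only [hf, sinCoeff]
    push_cast
    ring_nf
  have hpos : ∀ n : ℕ, f ((n : ℤ) + 1) = (1 / Real.pi ^ 2) *
      (4 / (((2 * (n + 1) : ℝ) ^ 2 * (a : ℝ) ^ 2 - 1) * ((2 * (n + 1) : ℝ) ^ 2 * (b : ℝ) ^ 2 - 1))) := by
    intro n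
    simp only [hf, sinCoeff]
    push_cast
    rw [div_mul_div_comm, div_mul_div_comm]
    congr 1 <;> ring
  have h0 : f 0 = 4 / Real.pi ^ 2 := by
    simp only [hf, sinCoeff]
    have := Real.pi_ne_zero
    simp
    field_simp
    norm_num
  simp only [hneg, hpos, tsum_mul_left, h0] at e
  rw [e]
  ring
end
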